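/- Let F be a field and n a natural number. Let R be an associative F-algebra without identity generated by two elements a, b satisfying a² = 0 and bⁿ = 0, and let R[x] be the polynomial ring in one central variable x over R. Let Q be the F-linear subspace of R[x] spanned by the elements a·bⁱ·xʲ for 0 < i < n and j ≥ 0. If for every k every k×k matrix with entries in Q is nilpotent, then R[x] is a Jacobson radical ring, and hence R is a nil ring (every element of R is nilpotent). -/

import Mathlib

namespace Paper

section NonUnital

variable {R : Type*} [NonUnitalRing R]

/-- The circle (adjoint) operation `a ∘ b = a·b + a + b` of a ring. -/
def circ (a b : R) : R := a * b + a + b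

/-- `npow' a n = a^{n+1}` (powers in a possibly nonunital ring). -/
def npow' (a : R) : ℕ → R
  | 0 => a
  | n + 1 => npow' a n * a

/-- `circPow a n` is the `n`-fold circle power `a ∘ a ∘ ⋯ ∘ a` (`circPow a 0 = 0`,
the identity of the adjoint group). -/
def circPow (a : R) : ℕ → R
  | 0 => 0
  | n + 1 => circ (circPow a n) a

/-- The left-normed Engel sequence in the adjoint group:
`engelChain qinv x y 0 = x` and
`engelChain qinv x y (n+1) = [engelChain qinv x y n, y]`, where the commutator
`[u, v] = u ∘ v ∘ u⁻¹ ∘ v⁻¹` is computed in the adjoint group, `qinv` giving the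
inverse (quasi-inverse) of each element. -/
def engelChain (qinv : R → R) (x y : R) : ℕ → R
  | 0 => x
  | n + 1 =>
    circ (circ (circ (engelChain qinv x y n) y) (qinv (engelChain qinv x y n))) (qinv y)

end NonUnital

lemma npow'_eq_pow {S : Type*} [Ring S] (x : S) (m : ℕ) : npow' x m = x ^ (m + 1) := by
  induction m with
  | zero => simp [npow']
  | succ m ih => rw [npow', ih, pow_succ _ (m + 1)]

lemma inr_npow' {F R : Type*} [Field F] [NonUnitalRing R] [Module F R]
    [SMulCommClass F R R] [IsScalarTower F R R] (x : R) (m : ℕ) :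
    ((npow' x m : R) : Unitization F R) = (x : Unitization F R) ^ (m + 1) := by
  induction m with
  | zero => simp [npow']
  | succ m ih => rw [npow', Unitization.inr_mul, ih, pow_succ _ (m + 1)]

lemma isUnit_one_add_of_isNilpotent_geom {E : Type*} [Ring E] {α β M N : E} {n : ℕ}
    (hα : α * α = 0) (hβ : β ^ (n + 1) = 0) (hM : Commute α M) (hN : Commute β N)
    (hq : IsNilpotent (α * M * ∑ i ∈ Finset.range n, (-(β * N)) ^ (i + 1))) :
    IsUnit (1 + (α * M + β * N)) := by
  set t : E := ∑ i ∈ Finset.range n, (-(β * N)) ^ (i + 1) with ht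
  have hpow : (-(β * N)) ^ (n + 1) = 0 := by
    rw [neg_pow, hN.mul_pow, hβ, zero_mul, mul_zero]
  have hu : IsUnit (1 + β * N) := by
    have h : IsNilpotent (β * N) := ⟨n + 1, by rw [hN.mul_pow, hβ, zero_mul]⟩
    exact h.isUnit_one_add
  have hgeom : (1 + t) * (1 + β * N) = 1 := by
    have h := geom_sum_mul_neg (-(β * N)) (n + 1)
    rw [hpow, Finset.sum_range_succ', pow_zero, ← ht, sub_neg_eq_add, sub_zero] at h
    rw [add_comm 1 t, h]
  have hsq : α * M * (α * M) = 0 := by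
    rw [mul_assoc, ← mul_assoc M, ← hM.eq, mul_assoc α M M, ← mul_assoc, hα, zero_mul]
  have hfac : 1 + (α * M + β * N) =
      (1 + α * M) * (1 + α * M * t) * (1 + β * N) := by
    have h1 : (1 + α * M) * (1 + α * M * t) = 1 + α * M * (1 + t) := by
      have h2 : α * M * (α * M * t) = 0 := by rw [← mul_assoc, hsq, zero_mul]
      rw [add_mul, mul_add, mul_add, h2]
      noncomm_ring
    rw [h1, add_mul, mul_assoc (α * M), hgeom]
    noncomm_ring
  rw [hfac]
  have hαM : IsNilpotent (α * M) := ⟨2, by rw [pow_two, hsq]⟩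
  exact (hαM.isUnit_one_add.mul hq.isUnit_one_add).mul hu

/-- All matrices `1 + M`, where `M` is a square matrix with entries in `W`, are invertible. -/
def MatrixRadical {P : Type*} [Ring P] (W : Set P) : Prop :=
  ∀ (ι : Type) [Fintype ι] [DecidableEq ι] (M : Matrix ι ι P),
    (∀ i j, M i j ∈ W) → IsUnit (1 + M)

lemma isUnit_schurComplement_of_isUnit_fromBlocks {ι P : Type*} [Fintype ι] [DecidableEq ι]
    [Ring P] {A B C : Matrix ι ι P} (h : IsUnit (Matrix.fromBlocks A B C 1)) :
    IsUnit (A - B * C) := by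
  obtain ⟨N, h1, h2⟩ := isUnit_iff_exists.1 h
  rw [← Matrix.fromBlocks_toBlocks N, Matrix.fromBlocks_multiply, ← Matrix.fromBlocks_one,
    Matrix.fromBlocks_inj] at h1 h2
  obtain ⟨h11, -, h21, -⟩ := h1
  obtain ⟨k11, k12, -, -⟩ := h2
  refine isUnit_iff_exists.2 ⟨N.toBlocks₁₁, ?_, ?_⟩
  · rw [one_mul] at h21
    rw [sub_mul, mul_assoc, eq_neg_of_add_eq_zero_left h21, ← h11]
    noncomm_ring
  · rw [mul_one] at k12
    rw [mul_sub, ← mul_assoc, eq_neg_of_add_eq_zero_left k12, ← k11]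
    noncomm_ring

lemma MatrixRadical.isUnit_one_add {P : Type*} [Ring P] {W : Set P} (hW : MatrixRadical W)
    {p : P} (hp : p ∈ W) : IsUnit (1 + p) := by
  have h := (hW Unit (Matrix.of fun _ _ => p) fun _ _ => hp).map
    (Matrix.uniqueRingEquiv (m := Unit) (A := P))
  simpa using h

section Linearization

variable {A P : Type*} [CommRing A] [Ring P] [Algebra A P]

lemma isNilpotent_matrix_of_fin {Q : Set P}
    (h : ∀ (k : ℕ) (M : Matrix (Fin k) (Fin k) P), (∀ i j, M i j ∈ Q) → IsNilpotent M)
    {ι : Type*} [Fintype ι] [DecidableEq ι] (M : Matrix ι ι P) (hM : ∀ i j, M i j ∈ Q) :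
    IsNilpotent M := by
  let e := Matrix.reindexRingEquiv P (Fintype.equivFin ι)
  have h1 : IsNilpotent (e M) := h _ _ fun i j => by
    simpa [e] using hM _ _
  simpa using h1.map e.symm

lemma MatrixRadical.span_pair {a b : P} {n : ℕ} {Q : AddSubgroup P} (ha : a * a = 0)
    (hb : b ^ (n + 1) = 0) (hQ : ∀ i < n, ∀ z : A, a * b ^ (i + 1) * algebraMap A P z ∈ Q)
    (hnil : ∀ (k : ℕ) (M : Matrix (Fin k) (Fin k) P), (∀ i j, M i j ∈ Q) → IsNilpotent M) :
    MatrixRadical (Submodule.span A {a, b} : Set P) := by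
  intro ι _ _ M hM
  have hM' : ∀ i j, ∃ c d : A, c • a + d • b = M i j := fun i j =>
    Submodule.mem_span_pair.1 (hM i j)
  choose c d hcd using hM'
  let φ : Matrix ι ι A →+* Matrix ι ι P := (algebraMap A P).mapMatrix
  let C : Matrix ι ι A := Matrix.of c
  let D : Matrix ι ι A := Matrix.of d
  have hcomm : ∀ (p : P) (N : Matrix ι ι A), Commute (Matrix.scalar ι p) (φ N) := fun p N => by
    apply Matrix.scalar_commute_iff.2
    ext i j
    simp [φ, Algebra.commutes]
  have hMeq : M = Matrix.scalar ι a * φ C + Matrix.scalar ι b * φ D := by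
    ext i j
    simp [φ, C, D, ← hcd, Algebra.smul_def, Algebra.commutes]
  rw [hMeq]
  refine isUnit_one_add_of_isNilpotent_geom (n := n) ?_ ?_ (hcomm _ _) (hcomm _ _) ?_
  · rw [← map_mul, ha, map_zero]
  · rw [← map_pow, hb, map_zero]
  · refine isNilpotent_matrix_of_fin (Q := Q) hnil _ fun i j => ?_
    rw [Finset.mul_sum, Matrix.sum_apply]
    refine sum_mem fun m hm => ?_
    have : Matrix.scalar ι a * φ C * (-(Matrix.scalar ι b * φ D)) ^ (m + 1) =
        Matrix.scalar ι (a * b ^ (m + 1)) * φ (C * (-D) ^ (m + 1)) := by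
      rw [← mul_neg, ← map_neg, (hcomm _ _).mul_pow, map_mul, map_mul, map_pow, map_pow,
        mul_assoc, ← mul_assoc (φ C), ← map_pow (Matrix.scalar ι), ← (hcomm (b ^ (m + 1)) C).eq]
      simp only [mul_assoc]
    rw [this]
    generalize C * (-D) ^ (m + 1) = N
    simpa [φ] using hQ m (Finset.mem_range.1 hm) (N i j)

lemma MatrixRadical.sup_map_mulLeft {W : Submodule A P} (hW : MatrixRadical (W : Set P)) {c : P}
    (hc : c ∈ W) : MatrixRadical (↑(W ⊔ W.map (LinearMap.mulLeft A c)) : Set P) := by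
  intro ι _ _ M hM
  have hM' : ∀ i j, ∃ l ∈ W, ∃ y ∈ W, l + c * y = M i j := fun i j => by
    obtain ⟨l, hl, _, ⟨y, hy, rfl⟩, h⟩ := Submodule.mem_sup.1 (hM i j)
    exact ⟨l, hl, y, hy, h⟩
  choose l hl y hy hly using hM'
  let L : Matrix ι ι P := Matrix.of l
  let Y : Matrix ι ι P := Matrix.of y
  have hM_eq : M = L + Matrix.scalar ι c * Y := by
    ext i j
    simp [L, Y, ← hly]
  have hblock := hW (ι ⊕ ι) (Matrix.fromBlocks L (-Matrix.scalar ι c) Y 0) (by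
    rintro (i | i) (j | j)
    · exact hl i j
    · rcases eq_or_ne i j with rfl | hij
      · simpa using hc
      · simp [hij]
    · exact hy i j
    · exact W.zero_mem)
  rw [← Matrix.fromBlocks_one, Matrix.fromBlocks_add, zero_add, zero_add, add_zero] at hblock
  rw [hM_eq, ← add_assoc]
  have h := isUnit_schurComplement_of_isUnit_fromBlocks hblock
  rwa [neg_mul, sub_neg_eq_add] at h

/-- Iterated enlargement of the span of `a` and `b` by left multiplication by `a` and `b`. -/
def wordSpan (A : Type*) {P : Type*} [CommRing A] [Ring P] [Algebra A P] (a b : P) :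
    ℕ → Submodule A P
  | 0 => Submodule.span A {a, b}
  | d + 1 =>
    let W := wordSpan A a b d ⊔ (wordSpan A a b d).map (LinearMap.mulLeft A a)
    W ⊔ W.map (LinearMap.mulLeft A b)

lemma left_mem_wordSpan (a b : P) (d : ℕ) : a ∈ wordSpan A a b d := by
  induction d with
  | zero => exact Submodule.subset_span (by simp)
  | succ d ih => exact Submodule.mem_sup_left (Submodule.mem_sup_left ih)

lemma right_mem_wordSpan (a b : P) (d : ℕ) : b ∈ wordSpan A a b d := by
  induction d with
  | zero => exact Submodule.subset_span (by simp)
  | succ d ih => exact Submodule.mem_sup_left (Submodule.mem_sup_left ih)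

lemma wordSpan_monotone (a b : P) : Monotone (wordSpan A a b) :=
  monotone_nat_of_le_succ fun _ => le_sup_left.trans le_sup_left

lemma mem_iSup_wordSpan {a b p : P} :
    p ∈ ⨆ d, wordSpan A a b d ↔ ∃ d, p ∈ wordSpan A a b d :=
  Submodule.mem_iSup_of_directed _ (wordSpan_monotone a b).directed_le

lemma left_mul_mem_iSup_wordSpan {a b p : P} (hp : p ∈ ⨆ d, wordSpan A a b d) :
    a * p ∈ ⨆ d, wordSpan A a b d := by
  obtain ⟨d, hd⟩ := mem_iSup_wordSpan.1 hp
  exact mem_iSup_wordSpan.2 ⟨d + 1, Submodule.mem_sup_left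
    (Submodule.mem_sup_right (Submodule.mem_map_of_mem hd))⟩

lemma right_mul_mem_iSup_wordSpan {a b p : P} (hp : p ∈ ⨆ d, wordSpan A a b d) :
    b * p ∈ ⨆ d, wordSpan A a b d := by
  obtain ⟨d, hd⟩ := mem_iSup_wordSpan.1 hp
  exact mem_iSup_wordSpan.2 ⟨d + 1, Submodule.mem_sup_right
    (Submodule.mem_map_of_mem (Submodule.mem_sup_left hd))⟩

lemma MatrixRadical.wordSpan {a b : P}
    (h : MatrixRadical (Submodule.span A {a, b} : Set P)) (d : ℕ) :
    MatrixRadical (wordSpan A a b d : Set P) := by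
  induction d with
  | zero => exact h
  | succ d ih =>
    exact (ih.sup_map_mulLeft (left_mem_wordSpan a b d)).sup_map_mulLeft
      (Submodule.mem_sup_left (right_mem_wordSpan a b d))

lemma MatrixRadical.isUnit_one_add_of_mem_iSup_wordSpan {a b p : P}
    (h : MatrixRadical (Submodule.span A {a, b} : Set P)) (hp : p ∈ ⨆ d, Paper.wordSpan A a b d) :
    IsUnit (1 + p) := by
  obtain ⟨d, hd⟩ := mem_iSup_wordSpan.1 hp
  exact (h.wordSpan d).isUnit_one_add hd

end Linearization

section Polynomial

open Polynomial

variable {F R : Type*} [Field F] [NonUnitalRing R] [Module F R] [SMulCommClass F R R]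
  [IsScalarTower F R R]

/-- Polynomials over a unital `F`-algebra `S` form an algebra over the central subring `F[X]`. -/
noncomputable abbrev polynomialAlgebra (F S : Type*) [Field F] [Ring S] [Algebra F S] :
    Algebra F[X] S[X] :=
  (mapRingHom (algebraMap F S)).toAlgebra' fun c p => by
    induction c using Polynomial.induction_on' with
    | add c d hc hd => rw [map_add, add_mul, mul_add, hc, hd]
    | monomial k c =>
      rw [coe_mapRingHom, map_monomial, ← C_mul_X_pow_eq_monomial, mul_assoc, X_pow_mul,
        ← mul_assoc, ← mul_assoc]
      congr 1
      ext i
      simp [Algebra.commutes]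

lemma mem_iSup_wordSpan_of_coeff_fst_eq_zero {a b : R}
    (hgen : NonUnitalAlgebra.adjoin F {a, b} = ⊤) (f : (Unitization F R)[X])
    (hf : ∀ k, (f.coeff k).fst = 0) :
    letI := polynomialAlgebra F (Unitization F R)
    f ∈ ⨆ d, wordSpan F[X] (C (a : Unitization F R)) (C (b : Unitization F R)) d := by
  let := polynomialAlgebra F (Unitization F R)
  set U := ⨆ d, wordSpan F[X] (C (a : Unitization F R)) (C (b : Unitization F R)) d
  have key : ∀ r : R, C (r : Unitization F R) ∈ U ∧
      ∀ u ∈ U, C (r : Unitization F R) * u ∈ U := fun r => by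
    have hr : r ∈ NonUnitalAlgebra.adjoin F {a, b} := hgen ▸ trivial
    induction hr using NonUnitalAlgebra.adjoin_induction with
    | mem x hx =>
      rcases hx with rfl | rfl
      · exact ⟨mem_iSup_wordSpan.2 ⟨0, left_mem_wordSpan _ _ _⟩,
          fun u hu => left_mul_mem_iSup_wordSpan hu⟩
      · exact ⟨mem_iSup_wordSpan.2 ⟨0, right_mem_wordSpan _ _ _⟩,
          fun u hu => right_mul_mem_iSup_wordSpan hu⟩
    | add x y _ _ hx hy =>
      rw [Unitization.inr_add, C_add]
      refine ⟨add_mem hx.1 hy.1, fun u hu => ?_⟩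
      rw [add_mul]
      exact add_mem (hx.2 u hu) (hy.2 u hu)
    | zero => simp
    | mul x y _ _ hx hy =>
      rw [Unitization.inr_mul, C_mul]
      refine ⟨hx.2 _ hy.1, fun u hu => ?_⟩
      rw [mul_assoc]
      exact hx.2 _ (hy.2 u hu)
    | smul c x _ hx =>
      have : C ((c • x : R) : Unitization F R) = (C c : F[X]) • C (x : Unitization F R) := by
        rw [Algebra.smul_def, RingHom.algebraMap_toAlgebra', coe_mapRingHom, map_C, ← C_mul,
          Unitization.inr_smul, Algebra.smul_def]
      rw [this]
      refine ⟨U.smul_mem _ hx.1, fun u hu => ?_⟩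
      rw [Algebra.smul_mul_assoc]
      exact U.smul_mem _ (hx.2 u hu)
  rw [f.as_sum_range_C_mul_X_pow]
  refine sum_mem fun k _ => ?_
  have hk : f.coeff k = ((f.coeff k).snd : Unitization F R) := by
    ext <;> simp [hf]
  have hX : C (f.coeff k) * X ^ k = (X ^ k : F[X]) • C (f.coeff k) := by
    rw [Algebra.smul_def, RingHom.algebraMap_toAlgebra', coe_mapRingHom, Polynomial.map_pow, map_X,
      X_pow_mul]
  rw [hX, hk]
  exact U.smul_mem _ (key _).1

lemma pow_eq_zero_of_one_sub_C_mul_X_mul_eq_one {S : Type*} [Ring S] {x : S} {g : S[X]}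
    (hg : (1 - C x * X) * g = 1) : x ^ (g.natDegree + 1) = 0 := by
  have hcoeff : ∀ k, g.coeff k = x ^ k := fun k => by
    induction k with
    | zero => simpa [sub_mul, mul_assoc, coeff_X_mul_zero] using congr_arg (coeff · 0) hg
    | succ k ih =>
      have h := congr_arg (coeff · (k + 1)) hg
      simp only [sub_mul, one_mul, mul_assoc, coeff_sub, coeff_C_mul, coeff_X_mul, ih, coeff_one,
        Nat.succ_ne_zero, if_false] at h
      rw [sub_eq_zero.1 h, pow_succ']
  rw [← hcoeff, coeff_eq_zero_of_natDegree_lt (Nat.lt_succ_self _)]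

/-- An element of `R[x]` which becomes a unit after adding `1` is quasi-regular in `R[x]`. -/
lemma exists_circ_eq_zero_of_isUnit_one_add {f : (Unitization F R)[X]}
    (hf : ∀ k, (f.coeff k).fst = 0) (hu : IsUnit (1 + f)) :
    ∃ g : (Unitization F R)[X], (∀ k, (g.coeff k).fst = 0) ∧ circ f g = 0 ∧ circ g f = 0 := by
  obtain ⟨h, h1, h2⟩ := isUnit_iff_exists.1 hu
  let π : (Unitization F R)[X] →+* F[X] := mapRingHom (Unitization.fstHom F R : _ →+* F)
  have hπ : ∀ p k, (π p).coeff k = (p.coeff k).fst := fun p k => by simp [π]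
  have hπf : π f = 0 := by
    ext k
    simp [hπ, hf]
  have hπh : π h = 1 := by simpa [hπf] using congr_arg π h1
  refine ⟨h - 1, fun k => ?_, ?_, ?_⟩
  · rw [← hπ, map_sub, hπh, map_one, sub_self, coeff_zero]
  · rw [circ, ← sub_eq_zero.2 h1, mul_sub, mul_one, add_mul, one_mul]
    abel
  · rw [circ, ← sub_eq_zero.2 h2, sub_mul, one_mul, mul_add, mul_one]
    abel

end Polynomial

/-- Let `F` be a field, `n` a natural number, and `R` an associative
`F`-algebra without identity generated by `a, b` with `a² = 0` and `bⁿ = 0`.  The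
polynomial ring `R[x]` is realized as the set of polynomials over the unitization
`R¹ = Unitization F R` all of whose coefficients lie in `R` (have zero scalar part).
Let `Q` be the `F`-linear span of the elements `a·bⁱ·xʲ` (`0 < i < n`, `0 ≤ j`).
If every square matrix with entries in `Q` is nilpotent, then `R[x]` is a Jacobson
radical ring, and hence `R` is nil. -/
theorem polynomial_radical_and_nil_of_matrices_nilpotent
    (F : Type) [Field F] (R : Type) [NonUnitalRing R] [Module F R]
    [SMulCommClass F R R] [IsScalarTower F R R]
    (n : ℕ) (hn : 0 < n) (a b : R)
    (hgen : NonUnitalAlgebra.adjoin F {a, b} = ⊤)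
    (ha : a * a = 0) (hb : npow' b (n - 1) = 0)
    (Q : Submodule F (Polynomial (Unitization F R)))
    (hQ : Q = Submodule.span F {f : Polynomial (Unitization F R) |
      ∃ i j : ℕ, 0 < i ∧ i < n ∧
        f = Polynomial.C ((a * npow' b (i - 1) : R) : Unitization F R) * Polynomial.X ^ j})
    (hmat : ∀ k : ℕ, ∀ M : Matrix (Fin k) (Fin k) (Polynomial (Unitization F R)),
      (∀ i j, M i j ∈ Q) → ∃ m : ℕ, npow' M m = 0) :
    (∀ f : Polynomial (Unitization F R), (∀ k, (f.coeff k).fst = 0) →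
      ∃ g : Polynomial (Unitization F R), (∀ k, (g.coeff k).fst = 0) ∧
        circ f g = 0 ∧ circ g f = 0) ∧
    (∀ x : R, ∃ m : ℕ, npow' x m = 0) := by
  let := polynomialAlgebra F (Unitization F R)
  obtain ⟨m, rfl⟩ : ∃ m, n = m + 1 := ⟨n - 1, by omega⟩
  have hrad : MatrixRadical (Submodule.span (Polynomial F)
      {Polynomial.C (a : Unitization F R), Polynomial.C (b : Unitization F R)} :
      Set (Polynomial (Unitization F R))) := by
    refine MatrixRadical.span_pair (n := m) (Q := Q.toAddSubgroup) ?_ ?_ ?_ ?_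
    · rw [← Polynomial.C_mul, ← Unitization.inr_mul, ha, Unitization.inr_zero, Polynomial.C_0]
    · rw [← Polynomial.C_pow, ← inr_npow', ← Nat.add_sub_cancel (n := m) (m := 1), hb,
        Unitization.inr_zero, Polynomial.C_0]
    · intro i hi z
      rw [Submodule.mem_toAddSubgroup, ← Polynomial.C_pow, ← inr_npow', ← Polynomial.C_mul,
        ← Unitization.inr_mul]
      induction z using Polynomial.induction_on' with
      | add p q hp hq =>
        rw [map_add, mul_add]
        exact add_mem hp hq
      | monomial k c =>
        have hc : Polynomial.C ((a * npow' b i : R) : Unitization F R) *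
            algebraMap (Polynomial F) (Polynomial (Unitization F R)) (Polynomial.monomial k c) =
            c • (Polynomial.C ((a * npow' b i : R) : Unitization F R) * Polynomial.X ^ k) := by
          rw [RingHom.algebraMap_toAlgebra', Polynomial.coe_mapRingHom, Polynomial.map_monomial,
            ← Polynomial.C_mul_X_pow_eq_monomial, ← mul_assoc, ← Polynomial.C_mul,
            ← Algebra.commutes, ← Algebra.smul_def, ← Polynomial.smul_C, smul_mul_assoc]
        rw [hc, hQ]
        exact Submodule.smul_mem _ _ (Submodule.subset_span
          ⟨i + 1, k, by omega, by omega, rfl⟩)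
    · intro k M hM
      obtain ⟨r, hr⟩ := hmat k M hM
      exact ⟨r + 1, by rw [← npow'_eq_pow, hr]⟩
  have hquasi : ∀ f : Polynomial (Unitization F R), (∀ k, (f.coeff k).fst = 0) →
      IsUnit (1 + f) := fun f hf =>
    hrad.isUnit_one_add_of_mem_iSup_wordSpan (mem_iSup_wordSpan_of_coeff_fst_eq_zero hgen f hf)
  refine ⟨fun f hf => exists_circ_eq_zero_of_isUnit_one_add hf (hquasi f hf), fun x => ?_⟩
  have hx := hquasi (-(Polynomial.C (x : Unitization F R) * Polynomial.X)) fun k => by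
    cases k <;> simp [Polynomial.coeff_C]
    split_ifs <;> simp
  rw [← sub_eq_add_neg] at hx
  obtain ⟨g, hg, -⟩ := isUnit_iff_exists.1 hx
  refine ⟨g.natDegree, Unitization.inr_injective (R := F) ?_⟩
  rw [inr_npow', pow_eq_zero_of_one_sub_C_mul_X_mul_eq_one hg, Unitization.inr_zero]

end Paper
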